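/- Let k = ρn for some ρ ∈ (0,1] with k and n positive integers. Let Q be a random n × k real matrix distributed according to the Haar probability measure on the Stiefel manifold V_k^n, and let G be an n × k random matrix with independent N(0, 1/n) entries. Then for every norm ⦀·⦀ on M^{n×k} satisfying the right operator ideal property ⦀AB⦀ ≤ ⦀A⦀·‖B‖ (where ‖·‖ is the spectral norm and the inequality holds for all n × k matrices A and k × k matrices B), one has E ⦀G⦀ ≤ (1 + √ρ) · E ⦀Q⦀. -/

import Mathlib

open MeasureTheory ProbabilityTheory Matrix

/-- The space of `n × k` real matrices carries the product measurable structure. -/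
instance matrixMeasurableSpace (n k : ℕ) : MeasurableSpace (Matrix (Fin n) (Fin k) ℝ) :=
  MeasurableSpace.pi

/-- The Euclidean (ℓ₂) norm of a vector in `ℝ^m`. -/
noncomputable def euclNorm {m : ℕ} (v : Fin m → ℝ) : ℝ :=
  Real.sqrt (∑ i, v i ^ 2)

/-- The spectral norm of an `a × b` real matrix: its operator norm `ℓ₂^b → ℓ₂^a`. -/
noncomputable def specNorm {a b : ℕ} (M : Matrix (Fin a) (Fin b) ℝ) : ℝ :=
  sSup {r : ℝ | ∃ x : Fin b → ℝ, euclNorm x ≤ 1 ∧ r = euclNorm (M.mulVec x)}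

lemma abs_sub_taylor_two_le {g g₁ g₂ g₃ : ℝ → ℝ} {C : ℝ}
    (h₀ : ∀ t, HasDerivAt g (g₁ t) t) (h₁ : ∀ t, HasDerivAt g₁ (g₂ t) t)
    (h₂ : ∀ t, HasDerivAt g₂ (g₃ t) t) (hC : ∀ t, |g₃ t| ≤ C) :
    |g 1 - g 0 - g₁ 0 - g₂ 0 / 2| ≤ C := by
  have key : ∀ {f f' : ℝ → ℝ}, (∀ t, HasDerivAt f (f' t) t) →
      (∀ t ∈ Set.Icc (0 : ℝ) 1, |f' t| ≤ C) → ∀ t ∈ Set.Icc (0 : ℝ) 1, |f t - f 0| ≤ C := by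
    intro f f' hf hb t ht
    have := (convex_Icc (0 : ℝ) 1).norm_image_sub_le_of_norm_hasDerivWithin_le
      (fun x _ => (hf x).hasDerivWithinAt) hb (Set.left_mem_Icc.2 zero_le_one) ht
    have hC0 : 0 ≤ C := (abs_nonneg _).trans (hC 0)
    rw [Real.norm_eq_abs, Real.norm_eq_abs, sub_zero, abs_of_nonneg ht.1] at this
    nlinarith [ht.2]
  have b₂ := key h₂ fun t _ => hC t
  have b₁ := key (f := fun t => g₁ t - t * g₂ 0) (f' := fun t => g₂ t - g₂ 0)
    (fun t => ((h₁ t).fun_sub ((hasDerivAt_id' t).mul_const (g₂ 0))).congr_deriv (by simp)) b₂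
  have b₀ := key (f := fun t => g t - t * g₁ 0 - t ^ 2 / 2 * g₂ 0)
    (f' := fun t => g₁ t - t * g₂ 0 - (g₁ 0 - 0 * g₂ 0)) (fun t => by
      refine (((h₀ t).sub ((hasDerivAt_id t).mul_const (g₁ 0))).sub
        ((((hasDerivAt_id t).pow 2).div_const 2).mul_const (g₂ 0))).congr_deriv ?_
      simp; ring) b₁ 1 (by simp)
  convert b₀ using 2
  ring

section LogSumExp

variable {S : Type*} [Fintype S]

/-- The function `x ↦ log ∑ exp x_s`, a smooth approximation of the maximum. -/
noncomputable def logSumExp (x : S → ℝ) : ℝ := Real.log (∑ s, Real.exp (x s))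

/-- The Gibbs weights attached to `x`. -/
noncomputable def gibbsWeight (x : S → ℝ) (s : S) : ℝ :=
  Real.exp (x s) / ∑ t, Real.exp (x t)

variable [Nonempty S]

lemma sum_exp_pos (x : S → ℝ) : 0 < ∑ s, Real.exp (x s) :=
  Finset.sum_pos (fun _ _ => Real.exp_pos _) Finset.univ_nonempty

lemma gibbsWeight_nonneg (x : S → ℝ) (s : S) : 0 ≤ gibbsWeight x s :=
  div_nonneg (Real.exp_pos _).le (sum_exp_pos x).le

lemma sum_gibbsWeight (x : S → ℝ) : ∑ s, gibbsWeight x s = 1 := by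
  simp only [gibbsWeight, ← Finset.sum_div]
  exact div_self (sum_exp_pos x).ne'

lemma continuous_logSumExp : Continuous (logSumExp (S := S)) :=
  Continuous.log (by fun_prop) fun x => (sum_exp_pos x).ne'

lemma le_logSumExp (x : S → ℝ) (s : S) : x s ≤ logSumExp x := by
  rw [logSumExp, Real.le_log_iff_exp_le (sum_exp_pos x)]
  exact Finset.single_le_sum (f := fun s => Real.exp (x s)) (fun _ _ => (Real.exp_pos _).le)
    (Finset.mem_univ s)

lemma logSumExp_le {x : S → ℝ} {c : ℝ} (h : ∀ s, x s ≤ c) :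
    logSumExp x ≤ c + Real.log (Fintype.card S) := by
  have hcard : (0 : ℝ) < Fintype.card S := by exact_mod_cast Fintype.card_pos
  rw [logSumExp, Real.log_le_iff_le_exp (sum_exp_pos x), Real.exp_add, Real.exp_log hcard,
    mul_comm, ← nsmul_eq_mul]
  exact Finset.sum_le_card_nsmul _ _ _ fun s _ => Real.exp_le_exp.2 (h s)

lemma abs_logSumExp_le (x : S → ℝ) : |logSumExp x| ≤ ‖x‖ + Real.log (Fintype.card S) := by
  have hx : ∀ s, |x s| ≤ ‖x‖ := norm_le_pi_norm x
  obtain ⟨s⟩ := ‹Nonempty S›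
  have hlog : 0 ≤ Real.log (Fintype.card S) := Real.log_natCast_nonneg _
  exact abs_le.2 ⟨by linarith [neg_le_of_abs_le (hx s), le_logSumExp x s],
    logSumExp_le fun s => (le_abs_self _).trans (hx s)⟩

lemma abs_gibbsWeight_sum_le (x z : S → ℝ) (i : ℕ) :
    |∑ s, gibbsWeight x s * z s ^ i| ≤ ‖z‖ ^ i := by
  calc |∑ s, gibbsWeight x s * z s ^ i| ≤ ∑ s, gibbsWeight x s * ‖z‖ ^ i := by
        refine (Finset.abs_sum_le_sum_abs _ _).trans (Finset.sum_le_sum fun s _ => ?_)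
        rw [abs_mul, abs_of_nonneg (gibbsWeight_nonneg x s), abs_pow]
        gcongr
        · exact gibbsWeight_nonneg x s
        · exact norm_le_pi_norm z s
    _ = ‖z‖ ^ i := by rw [← Finset.sum_mul, sum_gibbsWeight, one_mul]

lemma hasDerivAt_gibbsWeight_sum (x z : S → ℝ) (i : ℕ) (t : ℝ) :
    HasDerivAt (fun t => ∑ s, gibbsWeight (x + t • z) s * z s ^ i)
      (∑ s, gibbsWeight (x + t • z) s * z s ^ (i + 1) -
        (∑ s, gibbsWeight (x + t • z) s * z s ^ i) *
          ∑ s, gibbsWeight (x + t • z) s * z s ^ 1) t := by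
  have hexp : ∀ s, HasDerivAt (fun t => Real.exp ((x + t • z) s))
      (Real.exp ((x + t • z) s) * z s) t := fun s => by
    simpa using (((hasDerivAt_id t).mul_const (z s)).const_add (x s)).exp
  have hden : HasDerivAt (fun t => ∑ s, Real.exp ((x + t • z) s))
      (∑ s, Real.exp ((x + t • z) s) * z s) t := HasDerivAt.fun_sum fun s _ => hexp s
  have hnum : HasDerivAt (fun t => ∑ s, Real.exp ((x + t • z) s) * z s ^ i)
      (∑ s, Real.exp ((x + t • z) s) * z s * z s ^ i) t :=
    HasDerivAt.fun_sum fun s _ => (hexp s).mul_const _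
  have h0 := (sum_exp_pos (x + t • z)).ne'
  have key : ∀ (j : ℕ) (t : ℝ), ∑ s, gibbsWeight (x + t • z) s * z s ^ j =
      (∑ s, Real.exp ((x + t • z) s) * z s ^ j) / ∑ s, Real.exp ((x + t • z) s) := by
    intro j t
    rw [Finset.sum_div]
    exact Finset.sum_congr rfl fun s _ => by rw [gibbsWeight]; ring
  simp only [key]
  refine (hnum.div hden h0).congr_deriv ?_
  simp only [pow_one, mul_assoc, ← pow_succ']
  field_simp

lemma hasDerivAt_logSumExp (x z : S → ℝ) (t : ℝ) :
    HasDerivAt (fun t => logSumExp (x + t • z)) (∑ s, gibbsWeight (x + t • z) s * z s ^ 1) t := by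
  have hexp : ∀ s, HasDerivAt (fun t => Real.exp ((x + t • z) s))
      (Real.exp ((x + t • z) s) * z s) t := fun s => by
    simpa using (((hasDerivAt_id t).mul_const (z s)).const_add (x s)).exp
  have hden : HasDerivAt (fun t => ∑ s, Real.exp ((x + t • z) s))
      (∑ s, Real.exp ((x + t • z) s) * z s) t := HasDerivAt.fun_sum fun s _ => hexp s
  refine (hden.log (sum_exp_pos _).ne').congr_deriv ?_
  rw [Finset.sum_div]
  exact Finset.sum_congr rfl fun s _ => by rw [gibbsWeight]; ring

lemma gibbsWeight_variance_eq (x z : S → ℝ) :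
    ∑ s, gibbsWeight x s * z s ^ 2 - (∑ s, gibbsWeight x s * z s) ^ 2 =
      (∑ s, ∑ t, gibbsWeight x s * gibbsWeight x t * (z s - z t) ^ 2) / 2 := by
  have h : ∀ s t, gibbsWeight x s * gibbsWeight x t * (z s - z t) ^ 2 =
      gibbsWeight x s * z s ^ 2 * gibbsWeight x t + gibbsWeight x s * (gibbsWeight x t * z t ^ 2)
        - 2 * ((gibbsWeight x s * z s) * (gibbsWeight x t * z t)) := fun s t => by ring
  simp only [h, Finset.sum_sub_distrib, Finset.sum_add_distrib, ← Finset.mul_sum,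
    ← Finset.sum_mul, sum_gibbsWeight]
  ring

lemma abs_logSumExp_taylor_le (x z : S → ℝ) :
    |logSumExp (x + z) - logSumExp x - ∑ s, gibbsWeight x s * z s -
      (∑ s, ∑ t, gibbsWeight x s * gibbsWeight x t * (z s - z t) ^ 2) / 4| ≤ 6 * ‖z‖ ^ 3 := by
  set m : ℕ → ℝ → ℝ := fun i t => ∑ s, gibbsWeight (x + t • z) s * z s ^ i with hm
  have hd : ∀ i t, HasDerivAt (m i) (m (i + 1) t - m i t * m 1 t) t :=
    hasDerivAt_gibbsWeight_sum x z
  have hb : ∀ i t, |m i t| ≤ ‖z‖ ^ i := fun i t => abs_gibbsWeight_sum_le _ z i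
  have := abs_sub_taylor_two_le (g := fun t => logSumExp (x + t • z)) (g₁ := m 1)
    (g₂ := fun t => m 2 t - m 1 t * m 1 t)
    (g₃ := fun t => m 3 t - m 2 t * m 1 t - ((m 2 t - m 1 t * m 1 t) * m 1 t +
      m 1 t * (m 2 t - m 1 t * m 1 t))) (C := 6 * ‖z‖ ^ 3)
    (hasDerivAt_logSumExp x z) (hd 1) (fun t => (hd 2 t).sub ((hd 1 t).mul (hd 1 t)))
    (fun t => by
      have h1 : |m 1 t| ≤ ‖z‖ := by simpa using hb 1 t
      have h2 := hb 2 t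
      have h3 := hb 3 t
      have h21 : |m 2 t * m 1 t| ≤ ‖z‖ ^ 3 := by
        rw [abs_mul, pow_succ]
        exact mul_le_mul h2 h1 (abs_nonneg _) (by positivity)
      have h111 : |m 1 t ^ 3| ≤ ‖z‖ ^ 3 := by
        rw [abs_pow]; exact pow_le_pow_left₀ (abs_nonneg _) h1 3
      rw [abs_le] at *
      constructor <;> nlinarith)
  convert this using 2
  have hv := gibbsWeight_variance_eq x z
  simp only [hm, one_smul, zero_smul, add_zero, pow_one]
  linarith

end LogSumExp

section Comparison

variable {S E F : Type*}
  [NormedAddCommGroup E] [InnerProductSpace ℝ E] [FiniteDimensional ℝ E] [MeasurableSpace E]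
  [BorelSpace E] [NormedAddCommGroup F] [InnerProductSpace ℝ F] [FiniteDimensional ℝ F]
  [MeasurableSpace F] [BorelSpace F]

/-- The law at time `t` of the Brownian motion with covariance `A Aᵀ`. -/
noncomputable def gaussianAt (A : E →L[ℝ] (S → ℝ)) (t : ℝ) : Measure (S → ℝ) :=
  (stdGaussian E).map (√t • A)

lemma gaussianAt_zero (A : E →L[ℝ] (S → ℝ)) : gaussianAt A 0 = Measure.dirac 0 := by
  have h : ⇑(√0 • A) = fun _ => 0 := by ext; simp
  rw [gaussianAt, h, Measure.map_const]
  simp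

variable [Fintype S]

lemma integrable_logSumExp [Nonempty S] (μ : Measure (S → ℝ)) [IsGaussian μ] :
    Integrable logSumExp μ :=
  ((IsGaussian.integrable_id (μ := μ)).norm.add (integrable_const _)).mono'
    continuous_logSumExp.aestronglyMeasurable (ae_of_all _ abs_logSumExp_le)

instance (A : E →L[ℝ] (S → ℝ)) (t : ℝ) : IsGaussian (gaussianAt A t) :=
  inferInstanceAs (IsGaussian ((stdGaussian E).map (√t • A)))

lemma gaussianAt_conv (A : E →L[ℝ] (S → ℝ)) {s t : ℝ} (hs : 0 ≤ s) (ht : 0 ≤ t) :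
    gaussianAt A s ∗ gaussianAt A t = gaussianAt A (s + t) := by
  refine Measure.ext_of_charFunDual ?_
  ext L
  rw [charFunDual_conv]
  simp only [gaussianAt, charFunDual_map, charFunDual_stdGaussian,
    ContinuousLinearMap.comp_smul, norm_smul, Real.norm_eq_abs, abs_of_nonneg (Real.sqrt_nonneg _),
    ← Complex.exp_add]
  congr 1
  have h : ∀ {r : ℝ}, 0 ≤ r → ((√r : ℝ) : ℂ) ^ 2 = r := fun hr => by
    exact_mod_cast Real.sq_sqrt hr
  push_cast
  rw [mul_pow, mul_pow, mul_pow, h hs, h ht, h (add_nonneg hs ht)]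
  push_cast
  ring

lemma abs_integral_logSumExp_sub_le [Nonempty S] (A : E →L[ℝ] (S → ℝ)) {h : ℝ}
    (hh : 0 ≤ h) (x : S → ℝ) :
    |∫ z, logSumExp (x + z) ∂(gaussianAt A h) - logSumExp x -
      h * (∑ s, ∑ t, gibbsWeight x s * gibbsWeight x t *
        ∫ y, (A y s - A y t) ^ 2 ∂(stdGaussian E)) / 4| ≤
      6 * (h * √h) * ∫ y, ‖A y‖ ^ 3 ∂(stdGaussian E) := by
  have hA : ∀ p : ENNReal, p ≠ ⊤ → MemLp A p (stdGaussian E) := fun p hp =>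
    A.comp_memLp' (IsGaussian.memLp_id (stdGaussian E) p hp)
  have hcoord : ∀ s (p : ENNReal), p ≠ ⊤ → MemLp (fun y => A y s) p (stdGaussian E) := fun s p hp =>
    (hA p hp).mono (by fun_prop) (ae_of_all _ fun y => norm_le_pi_norm (A y) s)
  have hcube : Integrable (fun y => ‖A y‖ ^ 3) (stdGaussian E) :=
    (hA 3 (by simp)).integrable_norm_pow (by simp)
  have hsq : ∀ s t, Integrable (fun y => (A y s - A y t) ^ 2) (stdGaussian E) := fun s t =>
    ((hcoord s 2 (by simp)).sub (hcoord t 2 (by simp))).integrable_sq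
  have hlin : ∀ s, Integrable (fun y => A y s) (stdGaussian E) := fun s =>
    memLp_one_iff_integrable.1 (hcoord s 1 (by simp))
  have hmean : ∀ s, ∫ y, A y s ∂(stdGaussian E) = 0 := fun s =>
    integral_strongDual_stdGaussian ((ContinuousLinearMap.proj s).comp A)
  have hF : Integrable (fun y => logSumExp (x + √h • A y)) (stdGaussian E) := by
    have := integrable_logSumExp ((gaussianAt A h).map (fun z => x + z))
    rw [integrable_map_measure continuous_logSumExp.aestronglyMeasurable (by fun_prop)] at this
    rw [gaussianAt, integrable_map_measure
      (continuous_logSumExp.comp (by fun_prop)).aestronglyMeasurable (by fun_prop)] at this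
    exact this
  have hi1 : Integrable (fun y => ∑ s, gibbsWeight x s * (√h • A y) s) (stdGaussian E) :=
    integrable_finsetSum _ fun s _ => ((hlin s).const_mul _).const_mul _
  have hterm : ∀ s t y, gibbsWeight x s * gibbsWeight x t * ((√h • A y) s - (√h • A y) t) ^ 2 =
      h * (gibbsWeight x s * gibbsWeight x t * (A y s - A y t) ^ 2) := fun s t y => by
    simp only [Pi.smul_apply, smul_eq_mul, ← mul_sub, mul_pow, Real.sq_sqrt hh]
    ring
  have hi2 : Integrable (fun y => (∑ s, ∑ t, gibbsWeight x s * gibbsWeight x t *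
      ((√h • A y) s - (√h • A y) t) ^ 2) / 4) (stdGaussian E) := by
    simp only [hterm]
    exact (integrable_finsetSum _ fun s _ => integrable_finsetSum _ fun t _ =>
      ((hsq s t).const_mul _).const_mul _).div_const _
  have e1 : ∫ y, ∑ s, gibbsWeight x s * (√h • A y) s ∂(stdGaussian E) = 0 := by
    simp only [Pi.smul_apply, smul_eq_mul]
    rw [integral_finsetSum _ fun s _ => ((hlin s).const_mul _).const_mul _]
    simp [integral_const_mul, hmean]
  have e2 : ∫ y, (∑ s, ∑ t, gibbsWeight x s * gibbsWeight x t *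
      ((√h • A y) s - (√h • A y) t) ^ 2) / 4 ∂(stdGaussian E) =
      h * (∑ s, ∑ t, gibbsWeight x s * gibbsWeight x t *
        ∫ y, (A y s - A y t) ^ 2 ∂(stdGaussian E)) / 4 := by
    simp only [hterm]
    rw [integral_div, integral_finsetSum _ fun s _ => integrable_finsetSum _ fun t _ =>
      ((hsq s t).const_mul _).const_mul _, Finset.mul_sum]
    congr 1
    refine Finset.sum_congr rfl fun s _ => ?_
    rw [integral_finsetSum _ fun t _ => ((hsq s t).const_mul _).const_mul _]
    simp only [integral_const_mul, ← Finset.mul_sum]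
  have e0 : ∫ z, logSumExp (x + z) ∂(gaussianAt A h) =
      ∫ y, logSumExp (x + √h • A y) ∂(stdGaussian E) := by
    have hc : Continuous fun z : S → ℝ => logSumExp (x + z) :=
      continuous_logSumExp.comp (by fun_prop)
    rw [gaussianAt, integral_map (by fun_prop) hc.aestronglyMeasurable]
    rfl
  have e3 : ∫ y, (logSumExp (x + √h • A y) - logSumExp x - ∑ s, gibbsWeight x s * (√h • A y) s -
      (∑ s, ∑ t, gibbsWeight x s * gibbsWeight x t * ((√h • A y) s - (√h • A y) t) ^ 2) / 4)
        ∂(stdGaussian E) = ∫ z, logSumExp (x + z) ∂(gaussianAt A h) - logSumExp x -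
      h * (∑ s, ∑ t, gibbsWeight x s * gibbsWeight x t *
        ∫ y, (A y s - A y t) ^ 2 ∂(stdGaussian E)) / 4 := by
    have hF' : Integrable (fun y => logSumExp (x + √h • A y) - logSumExp x) (stdGaussian E) :=
      hF.sub (integrable_const _)
    have hF'' : Integrable (fun y => logSumExp (x + √h • A y) - logSumExp x -
        ∑ s, gibbsWeight x s * (√h • A y) s) (stdGaussian E) := hF'.sub hi1
    rw [integral_sub hF'' hi2, integral_sub hF' hi1, integral_sub hF (integrable_const _), e0, e1,
      e2]
    simp
  rw [← e3, ← integral_const_mul]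
  rw [← Real.norm_eq_abs]
  refine norm_integral_le_of_norm_le (hcube.const_mul _) (ae_of_all _ fun y => ?_)
  refine (abs_logSumExp_taylor_le x (√h • A y)).trans_eq ?_
  rw [norm_smul, Real.norm_eq_abs, abs_of_nonneg (Real.sqrt_nonneg h), mul_pow, pow_succ (√h),
    Real.sq_sqrt hh]
  ring

lemma integral_logSumExp_gaussianAt_le [Nonempty S] (A : E →L[ℝ] (S → ℝ)) (B : F →L[ℝ] (S → ℝ))
    (hAB : ∀ s t, ∫ y, (A y s - A y t) ^ 2 ∂(stdGaussian E) ≤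
      ∫ y, (B y s - B y t) ^ 2 ∂(stdGaussian F)) :
    ∫ z, logSumExp z ∂(gaussianAt A 1) ≤ ∫ z, logSumExp z ∂(gaussianAt B 1) := by
  set C : ℝ := 6 * ∫ y, ‖A y‖ ^ 3 ∂(stdGaussian E) + 6 * ∫ y, ‖B y‖ ^ 3 ∂(stdGaussian F) with hC
  have local_step : ∀ (h : ℝ), 0 ≤ h → ∀ x : S → ℝ, ∫ z, logSumExp (x + z) ∂(gaussianAt A h) ≤
      ∫ z, logSumExp (x + z) ∂(gaussianAt B h) + C * (h * √h) := by
    intro h hh x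
    have hA := (abs_le.1 (abs_integral_logSumExp_sub_le A hh x)).2
    have hB := (abs_le.1 (abs_integral_logSumExp_sub_le B hh x)).1
    have hsum : ∑ s, ∑ t, gibbsWeight x s * gibbsWeight x t *
        ∫ y, (A y s - A y t) ^ 2 ∂(stdGaussian E) ≤ ∑ s, ∑ t, gibbsWeight x s * gibbsWeight x t *
        ∫ y, (B y s - B y t) ^ 2 ∂(stdGaussian F) :=
      Finset.sum_le_sum fun s _ => Finset.sum_le_sum fun t _ => mul_le_mul_of_nonneg_left (hAB s t)
        (mul_nonneg (gibbsWeight_nonneg x s) (gibbsWeight_nonneg x t))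
    have := mul_le_mul_of_nonneg_left hsum hh
    rw [hC]
    linarith
  have conv_step : ∀ (h : ℝ), 0 ≤ h → ∀ μ : Measure (S → ℝ), IsGaussian μ →
      ∫ z, logSumExp z ∂(μ ∗ gaussianAt A h) ≤
        ∫ z, logSumExp z ∂(μ ∗ gaussianAt B h) + C * (h * √h) := by
    intro h hh μ _
    have hint : ∀ κ : Measure (S → ℝ), IsGaussian κ →
        Integrable (fun x => ∫ z, logSumExp (x + z) ∂κ) μ := fun κ _ => by
      have hi := integrable_logSumExp (μ ∗ κ)
      rw [Measure.conv, integrable_map_measure continuous_logSumExp.aestronglyMeasurable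
        (by fun_prop)] at hi
      exact hi.integral_prod_left
    rw [integral_conv (integrable_logSumExp (μ ∗ gaussianAt A h)),
      integral_conv (integrable_logSumExp (μ ∗ gaussianAt B h))]
    calc ∫ x, ∫ z, logSumExp (x + z) ∂(gaussianAt A h) ∂μ
        ≤ ∫ x, (∫ z, logSumExp (x + z) ∂(gaussianAt B h) + C * (h * √h)) ∂μ :=
          integral_mono (hint _ inferInstance) ((hint _ inferInstance).add (integrable_const _))
            (local_step h hh)
      _ = _ := by
          rw [integral_add (hint _ inferInstance) (integrable_const _)]
          simp
  have discrete : ∀ m : ℕ, 0 < m → ∫ z, logSumExp z ∂(gaussianAt A 1) ≤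
      ∫ z, logSumExp z ∂(gaussianAt B 1) + C * √((m : ℝ)⁻¹) := by
    intro m hm
    have hm' : (0 : ℝ) < m := by exact_mod_cast hm
    set h : ℝ := (m : ℝ)⁻¹ with hh
    have hh0 : 0 ≤ h := by positivity
    have hind : ∀ j : ℕ, j ≤ m → ∫ z, logSumExp z ∂(gaussianAt A (j * h) ∗
        gaussianAt B (1 - j * h)) ≤ ∫ z, logSumExp z ∂(gaussianAt B 1) + C * (j * (h * √h)) := by
      intro j hj
      induction j with
      | zero => simp [gaussianAt_zero]
      | succ j ih =>
        have hle : ((j + 1 : ℕ) : ℝ) * h ≤ 1 := by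
          rw [hh, ← div_eq_mul_inv, div_le_one hm']
          exact_mod_cast hj
        push_cast at hle ⊢
        have hjh : 0 ≤ (j : ℝ) * h := by positivity
        have hA' : gaussianAt A ((j + 1) * h) ∗ gaussianAt B (1 - (j + 1) * h) =
            (gaussianAt A (j * h) ∗ gaussianAt B (1 - (j + 1) * h)) ∗ gaussianAt A h := by
          rw [add_mul, one_mul, ← gaussianAt_conv A hjh hh0, Measure.conv_assoc,
            Measure.conv_comm (gaussianAt A h), ← Measure.conv_assoc]
        have hB' : gaussianAt A (j * h) ∗ gaussianAt B (1 - j * h) =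
            (gaussianAt A (j * h) ∗ gaussianAt B (1 - (j + 1) * h)) ∗ gaussianAt B h := by
          rw [Measure.conv_assoc, gaussianAt_conv B (by linarith) hh0]
          congr 2
          ring
        have h1 := conv_step h hh0 (gaussianAt A (j * h) ∗ gaussianAt B (1 - (j + 1) * h))
          inferInstance
        rw [← hA', ← hB'] at h1
        have h2 := ih (by omega)
        linarith
    have := hind m le_rfl
    have hmh : (m : ℝ) * h = 1 := mul_inv_cancel₀ hm'.ne'
    rwa [← mul_assoc (m : ℝ), hmh, sub_self, gaussianAt_zero, Measure.conv_dirac_zero,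
      one_mul] at this
  have hlim : Filter.Tendsto (fun m : ℕ => ∫ z, logSumExp z ∂(gaussianAt B 1) + C * √((m : ℝ)⁻¹))
      Filter.atTop (nhds (∫ z, logSumExp z ∂(gaussianAt B 1) + C * √0)) :=
    ((tendsto_inv_atTop_nhds_zero_nat (𝕜 := ℝ)).sqrt.const_mul C).const_add _
  simp only [Real.sqrt_zero, mul_zero, add_zero] at hlim
  exact ge_of_tendsto hlim (Filter.eventually_atTop.2 ⟨1, fun m hm => discrete m hm⟩)

end Comparison

section Chevet

open scoped RealInnerProductSpace

lemma integral_inner_sq_stdGaussian {E : Type*} [NormedAddCommGroup E] [InnerProductSpace ℝ E]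
    [FiniteDimensional ℝ E] [MeasurableSpace E] [BorelSpace E] (c : E) :
    ∫ y, ⟪c, y⟫ ^ 2 ∂(stdGaussian E) = ‖c‖ ^ 2 := by
  have h := variance_dual_stdGaussian (innerSL ℝ c)
  rw [variance_of_integral_eq_zero (by fun_prop) (integral_strongDual_stdGaussian _)] at h
  simpa using h

lemma integral_norm_le_sqrt_of_coord {F ι : Type*} [Fintype ι] [NormedAddCommGroup F]
    [InnerProductSpace ℝ F] [FiniteDimensional ℝ F] [MeasurableSpace F] [BorelSpace F]
    (L : F →L[ℝ] EuclideanSpace ℝ ι) (c : ι → F) (hc : ∀ i, ‖c i‖ = 1)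
    (hL : ∀ y i, L y i = ⟪c i, y⟫) :
    ∫ y, ‖L y‖ ∂(stdGaussian F) ≤ √(Fintype.card ι) := by
  have hmem : MemLp (fun y => ‖L y‖) 2 (stdGaussian F) :=
    (L.comp_memLp' (IsGaussian.memLp_id (stdGaussian F) 2 (by simp))).norm
  have hcoord : ∀ i, Integrable (fun y => ⟪c i, y⟫ ^ 2) (stdGaussian F) := fun i =>
    ((innerSL ℝ (c i)).comp_memLp' (IsGaussian.memLp_id (stdGaussian F) 2 (by simp))).integrable_sq
  have hvar := variance_nonneg (fun y => ‖L y‖) (stdGaussian F)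
  rw [variance_eq_sub hmem] at hvar
  have hsq : ∫ y, ‖L y‖ ^ 2 ∂(stdGaussian F) = Fintype.card ι := by
    simp only [EuclideanSpace.real_norm_sq_eq, hL]
    rw [integral_finsetSum _ fun i _ => hcoord i]
    simp [integral_inner_sq_stdGaussian, hc]
  refine Real.le_sqrt_of_sq_le ?_
  rw [← hsq]
  simpa using hvar

/-- The Sudakov–Fernique comparison inequality for finite Gaussian families. -/
lemma integral_sup_inner_le_of_dist_le {S E F : Type*} [Fintype S] [Nonempty S]
    [NormedAddCommGroup E] [InnerProductSpace ℝ E] [FiniteDimensional ℝ E] [MeasurableSpace E]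
    [BorelSpace E] [NormedAddCommGroup F] [InnerProductSpace ℝ F] [FiniteDimensional ℝ F]
    [MeasurableSpace F] [BorelSpace F] (a : S → E) (b : S → F)
    (hab : ∀ s t, ‖a s - a t‖ ≤ ‖b s - b t‖) {g : F → ℝ} (hg : Integrable g (stdGaussian F))
    (hbg : ∀ s y, ⟪b s, y⟫ ≤ g y) :
    Integrable (fun x => Finset.univ.sup' Finset.univ_nonempty fun s => ⟪a s, x⟫)
        (stdGaussian E) ∧
      ∫ x, Finset.univ.sup' Finset.univ_nonempty (fun s => ⟪a s, x⟫) ∂(stdGaussian E) ≤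
        ∫ y, g y ∂(stdGaussian F) := by
  set M : E → ℝ := fun x => Finset.univ.sup' Finset.univ_nonempty fun s => ⟪a s, x⟫ with hM
  have hMc : Continuous M := Continuous.finset_sup'_apply _ fun s _ => by fun_prop
  have hle : ∀ s x, ⟪a s, x⟫ ≤ M x := fun s x =>
    Finset.le_sup' (fun s => ⟪a s, x⟫) (Finset.mem_univ s)
  have hMi : Integrable M (stdGaussian E) := by
    have hid : Integrable (fun x : E => ‖x‖) (stdGaussian E) := IsGaussian.integrable_id.norm
    refine (hid.const_mul (∑ s, ‖a s‖)).mono' hMc.aestronglyMeasurable (ae_of_all _ fun x => ?_)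
    have hs : ∀ s, |⟪a s, x⟫| ≤ (∑ s, ‖a s‖) * ‖x‖ := fun s =>
      (abs_real_inner_le_norm _ _).trans (mul_le_mul_of_nonneg_right
        (Finset.single_le_sum (f := fun s => ‖a s‖) (fun _ _ => norm_nonneg _) (Finset.mem_univ s))
        (norm_nonneg x))
    obtain ⟨s⟩ := ‹Nonempty S›
    exact abs_le.2 ⟨(neg_le_of_abs_le (hs s)).trans (hle s x),
      Finset.sup'_le _ _ fun s _ => (le_abs_self _).trans (hs s)⟩
  refine ⟨hMi, ?_⟩
  have scaled : ∀ m : ℕ, 0 < m → ∫ x, M x ∂(stdGaussian E) ≤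
      ∫ y, g y ∂(stdGaussian F) + Real.log (Fintype.card S) * (m : ℝ)⁻¹ := by
    intro m hm
    have hm' : (0 : ℝ) < m := by exact_mod_cast hm
    let A : E →L[ℝ] (S → ℝ) := ContinuousLinearMap.pi fun s => (m : ℝ) • innerSL ℝ (a s)
    let B : F →L[ℝ] (S → ℝ) := ContinuousLinearMap.pi fun s => (m : ℝ) • innerSL ℝ (b s)
    have hA : ∀ x s, A x s = m * ⟪a s, x⟫ := fun x s => by simp [A]
    have hB : ∀ x s, B x s = m * ⟪b s, x⟫ := fun x s => by simp [B]
    have hAB : ∀ s t, ∫ y, (A y s - A y t) ^ 2 ∂(stdGaussian E) ≤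
        ∫ y, (B y s - B y t) ^ 2 ∂(stdGaussian F) := fun s t => by
      simp only [hA, hB, ← mul_sub, mul_pow, ← inner_sub_left, integral_const_mul,
        integral_inner_sq_stdGaussian]
      have := hab s t
      gcongr
    have hcmp := integral_logSumExp_gaussianAt_le A B hAB
    have eA : gaussianAt A 1 = (stdGaussian E).map A := by simp [gaussianAt]
    have eB : gaussianAt B 1 = (stdGaussian F).map B := by simp [gaussianAt]
    have iA := integrable_logSumExp ((stdGaussian E).map A)
    have iB := integrable_logSumExp ((stdGaussian F).map B)
    rw [integrable_map_measure continuous_logSumExp.aestronglyMeasurable (by fun_prop)] at iA iB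
    rw [eA, eB, integral_map (by fun_prop) continuous_logSumExp.aestronglyMeasurable,
      integral_map (by fun_prop) continuous_logSumExp.aestronglyMeasurable] at hcmp
    have lower : ∫ x, m * M x ∂(stdGaussian E) ≤ ∫ x, logSumExp (A x) ∂(stdGaussian E) := by
      refine integral_mono (hMi.const_mul _) iA fun x => ?_
      obtain ⟨s, -, hs⟩ := Finset.exists_mem_eq_sup' Finset.univ_nonempty fun s => ⟪a s, x⟫
      have := le_logSumExp (A x) s
      rw [hA, ← hs] at this
      exact this
    have upper : ∫ y, logSumExp (B y) ∂(stdGaussian F) ≤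
        ∫ y, (m * g y + Real.log (Fintype.card S)) ∂(stdGaussian F) := by
      refine integral_mono iB ((hg.const_mul _).add (integrable_const _)) fun y => ?_
      refine logSumExp_le fun s => ?_
      rw [hB]
      exact mul_le_mul_of_nonneg_left (hbg s y) hm'.le
    rw [integral_add (hg.const_mul _) (integrable_const _), integral_const_mul] at upper
    rw [integral_const_mul] at lower
    have := (lower.trans hcmp).trans upper
    simp only [integral_const, probReal_univ, one_smul] at this
    rw [← mul_le_mul_iff_right₀ hm', mul_add, mul_left_comm (m : ℝ), mul_inv_cancel₀ hm'.ne',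
      mul_one]
    exact this
  have hlim := ((tendsto_inv_atTop_nhds_zero_nat (𝕜 := ℝ)).const_mul
    (Real.log (Fintype.card S))).const_add (∫ y, g y ∂(stdGaussian F))
  rw [mul_zero, add_zero] at hlim
  exact ge_of_tendsto hlim (Filter.eventually_atTop.2 ⟨1, fun m hm => scaled m hm⟩)

variable {ι κ : Type*}

/-- The rank-one matrix `u vᵀ`, as an element of a Euclidean space. -/
noncomputable def rankOne (u : EuclideanSpace ℝ ι) (v : EuclideanSpace ℝ κ) :
    EuclideanSpace ℝ (ι × κ) :=
  WithLp.toLp 2 fun p => u p.1 * v p.2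

lemma continuous_rankOne :
    Continuous fun p : EuclideanSpace ℝ ι × EuclideanSpace ℝ κ => rankOne p.1 p.2 := by
  unfold rankOne
  fun_prop

variable [Fintype ι] [Fintype κ]

lemma inner_rankOne (u : EuclideanSpace ℝ ι) (v : EuclideanSpace ℝ κ)
    (x : EuclideanSpace ℝ (ι × κ)) :
    ⟪rankOne u v, x⟫ = ∑ i, u i * ∑ j, x (i, j) * v j := by
  simp only [PiLp.inner_apply, rankOne, Fintype.sum_prod_type, Finset.mul_sum]
  refine Finset.sum_congr rfl fun i _ => Finset.sum_congr rfl fun j _ => ?_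
  simp
  ring

lemma inner_rankOne_rankOne (u u' : EuclideanSpace ℝ ι) (v v' : EuclideanSpace ℝ κ) :
    ⟪rankOne u v, rankOne u' v'⟫ = ⟪u, u'⟫ * ⟪v, v'⟫ := by
  rw [inner_rankOne]
  simp only [PiLp.inner_apply, rankOne]
  rw [Finset.sum_mul_sum]
  refine Finset.sum_congr rfl fun i _ => ?_
  rw [Finset.mul_sum]
  refine Finset.sum_congr rfl fun j _ => ?_
  simp
  ring

lemma norm_rankOne_sub_le {u u' : EuclideanSpace ℝ ι} {v v' : EuclideanSpace ℝ κ}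
    (hu : ‖u‖ = 1) (hu' : ‖u'‖ = 1) (hv : ‖v‖ = 1) (hv' : ‖v'‖ = 1) :
    ‖rankOne u v - rankOne u' v'‖ ≤ ‖WithLp.toLp 2 (u, v) - WithLp.toLp 2 (u', v')‖ := by
  have h1 : ⟪u, u'⟫ ≤ 1 := by simpa [hu, hu'] using real_inner_le_norm u u'
  have h2 : ⟪v, v'⟫ ≤ 1 := by simpa [hv, hv'] using real_inner_le_norm v v'
  have e1 : ‖rankOne u v - rankOne u' v'‖ ^ 2 = 2 - 2 * (⟪u, u'⟫ * ⟪v, v'⟫) := by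
    rw [norm_sub_sq_real, ← real_inner_self_eq_norm_sq,
      ← real_inner_self_eq_norm_sq (rankOne u' v')]
    rw [inner_rankOne_rankOne, inner_rankOne_rankOne, inner_rankOne_rankOne]
    simp only [real_inner_self_eq_norm_sq, hu, hu', hv, hv']
    ring
  have e2 : ‖WithLp.toLp 2 (u, v) - WithLp.toLp 2 (u', v')‖ ^ 2 =
      4 - 2 * ⟪u, u'⟫ - 2 * ⟪v, v'⟫ := by
    rw [← WithLp.toLp_sub, WithLp.prod_norm_sq_eq_of_L2]
    change ‖u - u'‖ ^ 2 + ‖v - v'‖ ^ 2 = _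
    rw [norm_sub_sq_real, norm_sub_sq_real, hu, hu', hv, hv']
    ring
  refine abs_le_of_sq_le_sq' ?_ (norm_nonneg _) |>.2
  rw [e1, e2]
  nlinarith [mul_nonneg (sub_nonneg.2 h1) (sub_nonneg.2 h2)]

/-- Chevet's inequality for the spectral norm of a standard Gaussian matrix, in the form of an
integrable majorant. -/
lemma exists_integrable_rankOne_le [Nonempty ι] [Nonempty κ] {ε : ℝ} (hε : 0 < ε) :
    ∃ f : EuclideanSpace ℝ (ι × κ) → ℝ, Integrable f (stdGaussian _) ∧
      (∀ x u v, ‖u‖ = 1 → ‖v‖ = 1 → ⟪rankOne u v, x⟫ ≤ f x) ∧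
      ∫ x, f x ∂(stdGaussian _) ≤ √(Fintype.card ι) + √(Fintype.card κ) + ε := by
  classical
  have hid : Integrable (fun x : EuclideanSpace ℝ (ι × κ) => ‖x‖) (stdGaussian _) :=
    IsGaussian.integrable_id.norm
  set c : ℝ := ∫ x, ‖x‖ ∂(stdGaussian (EuclideanSpace ℝ (ι × κ))) with hc
  have hc0 : 0 ≤ c := integral_nonneg fun _ => norm_nonneg _
  set δ : ℝ := ε / (c + 1) with hδ
  have hδ0 : 0 < δ := by positivity
  let K : Set (EuclideanSpace ℝ ι × EuclideanSpace ℝ κ) :=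
    Metric.sphere 0 1 ×ˢ Metric.sphere 0 1
  have hK : IsCompact ((fun p : EuclideanSpace ℝ ι × EuclideanSpace ℝ κ => rankOne p.1 p.2) '' K) :=
    ((isCompact_sphere _ _).prod (isCompact_sphere _ _)).image continuous_rankOne
  obtain ⟨t, htK, htf, hcov⟩ := Set.exists_subset_image_finite_and.1
    (hK.finite_cover_balls hδ0)
  obtain ⟨i₀⟩ := ‹Nonempty ι›
  obtain ⟨j₀⟩ := ‹Nonempty κ›
  have hne : t.Nonempty := by
    by_contra hempty
    rw [Set.not_nonempty_iff_eq_empty] at hempty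
    have hmem : rankOne (EuclideanSpace.single i₀ (1 : ℝ)) (EuclideanSpace.single j₀ (1 : ℝ)) ∈
        (fun p : EuclideanSpace ℝ ι × EuclideanSpace ℝ κ => rankOne p.1 p.2) '' K :=
      ⟨(_, _), by simp [K], rfl⟩
    simpa [hempty] using hcov hmem
  have := htf.fintype
  have := hne.to_subtype
  have hmem : ∀ s : t, ‖s.1.1‖ = 1 ∧ ‖s.1.2‖ = 1 := fun s => by
    simpa [K] using htK s.2
  let L₁ : WithLp 2 (EuclideanSpace ℝ ι × EuclideanSpace ℝ κ) →L[ℝ] EuclideanSpace ℝ ι :=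
    WithLp.fstL 2 ℝ _ _
  let L₂ : WithLp 2 (EuclideanSpace ℝ ι × EuclideanSpace ℝ κ) →L[ℝ] EuclideanSpace ℝ κ :=
    WithLp.sndL 2 ℝ _ _
  have i₁ : Integrable (fun y => ‖L₁ y‖) (stdGaussian _) :=
    (L₁.integrable_comp IsGaussian.integrable_id).norm
  have i₂ : Integrable (fun y => ‖L₂ y‖) (stdGaussian _) :=
    (L₂.integrable_comp IsGaussian.integrable_id).norm
  obtain ⟨hMi, hMle⟩ := integral_sup_inner_le_of_dist_le
    (fun s : t => rankOne s.1.1 s.1.2) (fun s : t => WithLp.toLp 2 (s.1.1, s.1.2))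
    (fun s s' => norm_rankOne_sub_le (hmem s).1 (hmem s').1 (hmem s).2 (hmem s').2)
    (i₁.add i₂) (fun s y => by
      have h1 := real_inner_le_norm s.1.1 (L₁ y)
      have h2 := real_inner_le_norm s.1.2 (L₂ y)
      rw [(hmem s).1, one_mul] at h1
      rw [(hmem s).2, one_mul] at h2
      rw [WithLp.prod_inner_apply]
      exact add_le_add h1 h2)
  refine ⟨_, hMi.add (hid.const_mul δ), fun x u v hu hv => ?_, ?_⟩
  · have hx := hcov ⟨(u, v), by simp [K, hu, hv], rfl⟩
    simp only [Set.mem_iUnion, Set.mem_image, exists_prop, exists_exists_and_eq_and] at hx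
    obtain ⟨s, hs, hdist⟩ := hx
    rw [Metric.mem_ball, dist_eq_norm] at hdist
    have h1 : ⟪rankOne s.1 s.2, x⟫ ≤ Finset.univ.sup' Finset.univ_nonempty
        fun s : t => ⟪rankOne s.1.1 s.1.2, x⟫ :=
      Finset.le_sup' (fun s : t => ⟪rankOne s.1.1 s.1.2, x⟫) (Finset.mem_univ ⟨s, hs⟩)
    have h2 : ⟪rankOne u v - rankOne s.1 s.2, x⟫ ≤ δ * ‖x‖ :=
      (real_inner_le_norm _ _).trans (mul_le_mul_of_nonneg_right hdist.le (norm_nonneg _))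
    rw [inner_sub_left] at h2
    simp only [Pi.add_apply]
    linarith
  · have e₁ : ∫ y, ‖L₁ y‖ ∂(stdGaussian _) ≤ √(Fintype.card ι) :=
      integral_norm_le_sqrt_of_coord L₁ (fun i => WithLp.toLp 2 (EuclideanSpace.single i 1, 0))
        (fun i => by simp)
        (fun y i => by simp [L₁, WithLp.prod_inner_apply, EuclideanSpace.inner_single_left])
    have e₂ : ∫ y, ‖L₂ y‖ ∂(stdGaussian _) ≤ √(Fintype.card κ) :=
      integral_norm_le_sqrt_of_coord L₂ (fun i => WithLp.toLp 2 (0, EuclideanSpace.single i 1))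
        (fun i => by simp)
        (fun y i => by simp [L₂, WithLp.prod_inner_apply, EuclideanSpace.inner_single_left])
    have e₃ : δ * c ≤ ε := by
      rw [hδ, div_mul_eq_mul_div, div_le_iff₀ (by linarith)]
      nlinarith
    rw [integral_add' hMi (hid.const_mul δ), integral_const_mul]
    rw [integral_add' i₁ i₂] at hMle
    linarith

end Chevet

section Factorization

/-- The identity embedding `ℝ^k → ℝ^n` as an `n × k` matrix. -/
def coordEmbed {n k : ℕ} (h : k ≤ n) : Matrix (Fin n) (Fin k) ℝ :=
  (1 : Matrix (Fin n) (Fin n) ℝ).submatrix id (Fin.castLE h)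

lemma coordEmbed_mul_apply {n k m : ℕ} (h : k ≤ n) (S : Matrix (Fin k) (Fin m) ℝ) (i : Fin n)
    (j : Fin m) :
    (coordEmbed h * S) i j = if hi : i.1 < k then S ⟨i.1, hi⟩ j else 0 := by
  rw [Matrix.mul_apply]
  split_ifs with hi
  · rw [Finset.sum_eq_single ⟨i.1, hi⟩]
    · have : i = Fin.castLE h ⟨i.1, hi⟩ := rfl
      simp [coordEmbed, Matrix.one_apply, ← this]
    · rintro l - hl
      have : i ≠ Fin.castLE h l := by
        rintro rfl
        exact hl rfl
      simp [coordEmbed, this]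
    · simp
  · refine Finset.sum_eq_zero fun l _ => ?_
    have : i ≠ Fin.castLE h l := by
      rintro rfl
      exact hi l.2
    simp [coordEmbed, this]

lemma coordEmbed_transpose_mul_self {n k : ℕ} (h : k ≤ n) :
    (coordEmbed h)ᵀ * coordEmbed h = 1 := by
  ext i j
  simp [coordEmbed, Matrix.mul_apply, Matrix.one_apply, (Fin.castLE_injective h).eq_iff]

/-- The QR decomposition. -/
lemma exists_orthogonal_mul_coordEmbed_mul {n k : ℕ} (h : k ≤ n) (G : Matrix (Fin n) (Fin k) ℝ) :
    ∃ V ∈ Matrix.orthogonalGroup (Fin n) ℝ, ∃ S : Matrix (Fin k) (Fin k) ℝ,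
      G = V * (coordEmbed h * S) := by
  let g : Fin n → EuclideanSpace ℝ (Fin n) := fun j =>
    if hj : j.1 < k then WithLp.toLp 2 fun i => G i ⟨j.1, hj⟩ else 0
  let b := InnerProductSpace.gramSchmidtOrthonormalBasis (𝕜 := ℝ) (ι := Fin n) (by simp) g
  let V : Matrix (Fin n) (Fin n) ℝ := Matrix.of fun i j => b j i
  have hV : Vᵀ * V = 1 := by
    ext i j
    have := orthonormal_iff_ite.1 b.orthonormal i j
    simp only [PiLp.inner_apply] at this
    simp only [Matrix.mul_apply, Matrix.transpose_apply, Matrix.one_apply, V, Matrix.of_apply,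
      ← this]
    exact Finset.sum_congr rfl fun l _ => by simp [mul_comm]
  have hV' : V * Vᵀ = 1 := mul_eq_one_comm.1 hV
  refine ⟨V, (Matrix.mem_orthogonalGroup_iff' _ _).2 hV,
    (Vᵀ * G).submatrix (Fin.castLE h) id, ?_⟩
  have key : coordEmbed h * (Vᵀ * G).submatrix (Fin.castLE h) id = Vᵀ * G := by
    ext i j
    rw [coordEmbed_mul_apply]
    split_ifs with hi
    · rfl
    · have hlt : Fin.castLE h j < i := by
        rw [Fin.lt_def]
        exact j.2.trans_le (not_lt.1 hi)
      have := InnerProductSpace.gramSchmidtOrthonormalBasis_inv_triangular (𝕜 := ℝ) (ι := Fin n)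
        (by simp) g hlt
      rw [PiLp.inner_apply] at this
      simp only [Matrix.mul_apply, Matrix.transpose_apply]
      rw [← this]
      refine Finset.sum_congr rfl fun l _ => ?_
      simp [g, V, b, mul_comm]
  rw [key, ← Matrix.mul_assoc, hV', Matrix.one_mul]

lemma euclNorm_eq_norm {m : ℕ} (v : Fin m → ℝ) : euclNorm v = ‖WithLp.toLp 2 v‖ := by
  simp [euclNorm, EuclideanSpace.norm_eq]

lemma euclNorm_mulVec_of_transpose_mul_self {m l : ℕ} {P : Matrix (Fin m) (Fin l) ℝ}
    (hP : Pᵀ * P = 1) (v : Fin l → ℝ) : euclNorm (P *ᵥ v) = euclNorm v := by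
  have h : (P *ᵥ v) ⬝ᵥ (P *ᵥ v) = v ⬝ᵥ v := by
    rw [Matrix.dotProduct_mulVec, Matrix.vecMul_mulVec, hP, Matrix.vecMul_one]
  simp only [dotProduct, ← sq] at h
  rw [euclNorm, euclNorm, h]

lemma specNorm_le {a b : ℕ} {M : Matrix (Fin a) (Fin b) ℝ} {c : ℝ}
    (h : ∀ x, euclNorm x ≤ 1 → euclNorm (M *ᵥ x) ≤ c) : specNorm M ≤ c :=
  csSup_le ⟨_, 0, by simp [euclNorm], rfl⟩ (by rintro r ⟨x, hx, rfl⟩; exact h x hx)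

end Factorization

section Average

variable {n k : ℕ}

instance : BorelSpace (Matrix (Fin n) (Fin k) ℝ) :=
  inferInstanceAs (BorelSpace (Fin n → Fin k → ℝ))

instance : SecondCountableTopology (Matrix (Fin n) (Fin k) ℝ) :=
  inferInstanceAs (SecondCountableTopology (Fin n → Fin k → ℝ))

lemma measurable_matrix_mul_left (U : Matrix (Fin n) (Fin n) ℝ) :
    Measurable fun A : Matrix (Fin n) (Fin k) ℝ => U * A :=
  Continuous.measurable (by fun_prop)

lemma measurable_matrix_entry (i : Fin n) (j : Fin k) :
    Measurable fun A : Matrix (Fin n) (Fin k) ℝ => A i j :=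
  Continuous.measurable (by fun_prop)

lemma seminorm_le_sum_entry (p : Seminorm ℝ (Matrix (Fin n) (Fin k) ℝ))
    (A : Matrix (Fin n) (Fin k) ℝ) :
    p A ≤ ∑ i, ∑ j, |A i j| * p (Matrix.single i j 1) := by
  conv_lhs => rw [Matrix.matrix_eq_sum_single A]
  refine (Finset.le_sum_of_subadditive p (map_zero p).le (map_add_le_add p) _ _).trans
    (Finset.sum_le_sum fun i _ => (Finset.le_sum_of_subadditive p (map_zero p).le
      (map_add_le_add p) _ _).trans (Finset.sum_le_sum fun j _ => ?_))
  have : Matrix.single i j (A i j) = A i j • Matrix.single i j (1 : ℝ) := by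
    simp
  rw [this, map_smul_eq_mul, Real.norm_eq_abs]

lemma continuous_matrix_seminorm (p : Seminorm ℝ (Matrix (Fin n) (Fin k) ℝ)) : Continuous p := by
  refine Seminorm.continuous_of_continuousAt_zero ?_
  have hlim : Filter.Tendsto (fun A : Matrix (Fin n) (Fin k) ℝ =>
      ∑ i, ∑ j, |A i j| * p (Matrix.single i j 1)) (nhds 0) (nhds 0) := by
    have : Continuous fun A : Matrix (Fin n) (Fin k) ℝ =>
        ∑ i, ∑ j, |A i j| * p (Matrix.single i j 1) := by fun_prop
    simpa using this.tendsto 0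
  rw [ContinuousAt, map_zero]
  exact squeeze_zero (fun A => apply_nonneg p A) (seminorm_le_sum_entry p) hlim

lemma abs_entry_le_one_of_transpose_mul_self {P : Matrix (Fin n) (Fin k) ℝ} (hP : Pᵀ * P = 1)
    (i : Fin n) (j : Fin k) : |P i j| ≤ 1 := by
  have h : ∑ l, P l j ^ 2 = 1 := by
    simpa [Matrix.mul_apply, sq] using congrFun (congrFun hP j) j
  rw [← sq_le_one_iff_abs_le_one, ← h]
  exact Finset.single_le_sum (f := fun l => P l j ^ 2) (fun _ _ => sq_nonneg _)
    (Finset.mem_univ i)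

instance : CompactSpace (Matrix.orthogonalGroup (Fin n) ℝ) := by
  refine isCompact_iff_compactSpace.1 (IsCompact.of_isClosed_subset
    (isCompact_univ_pi fun _ => isCompact_univ_pi fun _ => isCompact_Icc (a := (-1 : ℝ)) (b := 1))
    isClosed_unitary fun U hU i _ j _ => ?_)
  exact abs_le.1 (abs_entry_le_one_of_transpose_mul_self
    ((Matrix.mem_orthogonalGroup_iff' _ _).1 hU) i j)

lemma exists_isMulRightInvariant_orthogonalGroup (n : ℕ) :
    ∃ H : Measure (Matrix.orthogonalGroup (Fin n) ℝ),
      IsProbabilityMeasure H ∧ H.IsMulRightInvariant := by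
  let μ := Measure.haarMeasure (⊤ : TopologicalSpace.PositiveCompacts
    (Matrix.orthogonalGroup (Fin n) ℝ))
  have : IsProbabilityMeasure μ := ⟨Measure.haarMeasure_self⟩
  exact ⟨μ.inv, ⟨by simp [Measure.inv_apply]⟩, inferInstance⟩

variable (H : Measure (Matrix.orthogonalGroup (Fin n) ℝ))
  (p : Seminorm ℝ (Matrix (Fin n) (Fin k) ℝ))

/-- The average of a seminorm over the left action of the orthogonal group. -/
noncomputable def orthogonalAverage (A : Matrix (Fin n) (Fin k) ℝ) : ℝ :=
  ∫ U, p (U.1 * A) ∂H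

lemma orthogonalAverage_nonneg (A : Matrix (Fin n) (Fin k) ℝ) : 0 ≤ orthogonalAverage H p A :=
  integral_nonneg fun _ => apply_nonneg p _

lemma orthogonalAverage_mul_left [H.IsMulRightInvariant] {V : Matrix (Fin n) (Fin n) ℝ}
    (hV : V ∈ Matrix.orthogonalGroup (Fin n) ℝ) (A : Matrix (Fin n) (Fin k) ℝ) :
    orthogonalAverage H p (V * A) = orthogonalAverage H p A := by
  have := integral_mul_right_eq_self (μ := H) (fun U => p (U.1 * A)) ⟨V, hV⟩
  rw [orthogonalAverage, orthogonalAverage, ← this]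
  simp [Matrix.mul_assoc]

lemma continuous_seminorm_smul :
    Continuous fun z : Matrix.orthogonalGroup (Fin n) ℝ × Matrix (Fin n) (Fin k) ℝ =>
      p (z.1.1 * z.2) :=
  (continuous_matrix_seminorm p).comp (by fun_prop)

variable [IsProbabilityMeasure H]

lemma integrable_seminorm_smul (A : Matrix (Fin n) (Fin k) ℝ) :
    Integrable (fun U : Matrix.orthogonalGroup (Fin n) ℝ => p (U.1 * A)) H := by
  have : Continuous fun U : Matrix.orthogonalGroup (Fin n) ℝ => p (U.1 * A) :=
    (continuous_matrix_seminorm p).comp (by fun_prop)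
  exact this.integrable_of_hasCompactSupport (HasCompactSupport.of_compactSpace _)

lemma orthogonalAverage_mul_right_le (hp : ∀ A B, p (A * B) ≤ p A * specNorm B)
    (A : Matrix (Fin n) (Fin k) ℝ) (S : Matrix (Fin k) (Fin k) ℝ) :
    orthogonalAverage H p (A * S) ≤ orthogonalAverage H p A * specNorm S := by
  rw [orthogonalAverage, orthogonalAverage, ← integral_mul_const]
  refine integral_mono (integrable_seminorm_smul H p _)
    ((integrable_seminorm_smul H p _).mul_const _) fun U => ?_
  simp only [← Matrix.mul_assoc]
  exact hp _ _

lemma orthogonalAverage_le [H.IsMulRightInvariant] (hp : ∀ A B, p (A * B) ≤ p A * specNorm B)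
    (h : k ≤ n) {G : Matrix (Fin n) (Fin k) ℝ} {c : ℝ}
    (hG : ∀ x, euclNorm x ≤ 1 → euclNorm (G *ᵥ x) ≤ c) :
    orthogonalAverage H p G ≤ orthogonalAverage H p (coordEmbed h) * c := by
  obtain ⟨V, hV, S, rfl⟩ := exists_orthogonal_mul_coordEmbed_mul h G
  rw [orthogonalAverage_mul_left H p hV]
  refine (orthogonalAverage_mul_right_le H p hp _ _).trans
    (mul_le_mul_of_nonneg_left (specNorm_le fun x hx => ?_) (orthogonalAverage_nonneg H p _))
  have := hG x hx
  rwa [← Matrix.mulVec_mulVec, ← Matrix.mulVec_mulVec, euclNorm_mulVec_of_transpose_mul_self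
    ((Matrix.mem_orthogonalGroup_iff' _ _).1 hV), euclNorm_mulVec_of_transpose_mul_self
    (coordEmbed_transpose_mul_self h)] at this

lemma orthogonalAverage_coordEmbed_le [H.IsMulRightInvariant]
    (hp : ∀ A B, p (A * B) ≤ p A * specNorm B) (h : k ≤ n) {Q : Matrix (Fin n) (Fin k) ℝ}
    (hQ : Qᵀ * Q = 1) :
    orthogonalAverage H p (coordEmbed h) ≤ orthogonalAverage H p Q := by
  obtain ⟨V, hV, S, rfl⟩ := exists_orthogonal_mul_coordEmbed_mul h Q
  have hV' := (Matrix.mem_orthogonalGroup_iff' _ _).1 hV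
  have hS : Sᵀ * S = 1 := by
    rw [← hQ]
    simp only [Matrix.transpose_mul, Matrix.mul_assoc]
    rw [← Matrix.mul_assoc Vᵀ, hV', Matrix.one_mul, ← Matrix.mul_assoc (coordEmbed h)ᵀ,
      coordEmbed_transpose_mul_self, Matrix.one_mul]
  have hS' : S * Sᵀ = 1 := mul_eq_one_comm.1 hS
  rw [orthogonalAverage_mul_left H p hV]
  calc orthogonalAverage H p (coordEmbed h)
      = orthogonalAverage H p (coordEmbed h * S * Sᵀ) := by
        rw [Matrix.mul_assoc, hS', Matrix.mul_one]
    _ ≤ orthogonalAverage H p (coordEmbed h * S) * specNorm Sᵀ :=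
        orthogonalAverage_mul_right_le H p hp _ _
    _ ≤ orthogonalAverage H p (coordEmbed h * S) := by
        refine mul_le_of_le_one_right (orthogonalAverage_nonneg H p _) (specNorm_le fun x hx => ?_)
        rwa [euclNorm_mulVec_of_transpose_mul_self (by rwa [Matrix.transpose_transpose])]

variable {m : Measure (Matrix (Fin n) (Fin k) ℝ)} [IsProbabilityMeasure m]

lemma integrable_prod_seminorm_smul (hm : ∀ i j, Integrable (fun A => A i j) m) :
    Integrable (fun z : Matrix.orthogonalGroup (Fin n) ℝ × Matrix (Fin n) (Fin k) ℝ =>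
      p (z.1.1 * z.2)) (H.prod m) := by
  have hb : Integrable (fun A : Matrix (Fin n) (Fin k) ℝ =>
      ∑ i, ∑ j, (∑ l, |A l j|) * p (Matrix.single i j 1)) m :=
    integrable_finsetSum _ fun i _ => integrable_finsetSum _ fun j _ =>
      (integrable_finsetSum _ fun l _ => (hm l j).abs).mul_const _
  refine (hb.comp_snd H).mono' (continuous_seminorm_smul p).aestronglyMeasurable
    (ae_of_all _ fun z => ?_)
  rw [Real.norm_of_nonneg (apply_nonneg p _)]
  refine (seminorm_le_sum_entry p _).trans (Finset.sum_le_sum fun i _ =>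
    Finset.sum_le_sum fun j _ => mul_le_mul_of_nonneg_right ?_ (apply_nonneg p _))
  rw [Matrix.mul_apply]
  refine (Finset.abs_sum_le_sum_abs _ _).trans (Finset.sum_le_sum fun l _ => ?_)
  rw [abs_mul]
  exact mul_le_of_le_one_left (abs_nonneg _) (abs_entry_le_one_of_transpose_mul_self
    ((Matrix.mem_orthogonalGroup_iff' _ _).1 z.1.2) i l)

lemma integrable_orthogonalAverage (hm : ∀ i j, Integrable (fun A => A i j) m) :
    Integrable (orthogonalAverage H p) m :=
  (integrable_prod_seminorm_smul H p hm).integral_prod_right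

lemma integral_orthogonalAverage (hm : ∀ i j, Integrable (fun A => A i j) m)
    (hinv : ∀ U : Matrix (Fin n) (Fin n) ℝ, Uᵀ * U = 1 → m.map (fun A => U * A) = m) :
    ∫ A, orthogonalAverage H p A ∂m = ∫ A, p A ∂m := by
  have hswap := integral_integral_swap
    (f := fun (U : Matrix.orthogonalGroup (Fin n) ℝ) A => p (U.1 * A))
    (integrable_prod_seminorm_smul H p hm)
  have hU : ∀ U : Matrix.orthogonalGroup (Fin n) ℝ, ∫ A, p (U.1 * A) ∂m = ∫ A, p A ∂m := fun U => by
    have hmap := hinv U.1 ((Matrix.mem_orthogonalGroup_iff' _ _).1 U.2)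
    conv_rhs => rw [← hmap]
    rw [integral_map (measurable_matrix_mul_left U.1).aemeasurable
      (continuous_matrix_seminorm p).aestronglyMeasurable]
  simp only [hU, integral_const, probReal_univ, one_smul] at hswap
  exact hswap.symm

end Average

section GaussianMatrix

variable {n k : ℕ}

/-- The matrix with entries `c * x (i, j)`. -/
def scaledMatrix (c : ℝ) (x : EuclideanSpace ℝ (Fin n × Fin k)) : Matrix (Fin n) (Fin k) ℝ :=
  Matrix.of fun i j => c * x (i, j)

lemma continuous_scaledMatrix (c : ℝ) : Continuous (scaledMatrix (n := n) (k := k) c) := by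
  refine continuous_matrix fun i j => ?_
  simp only [scaledMatrix, Matrix.of_apply]
  fun_prop

lemma pi_gaussianReal_eq_map_stdGaussian (v : NNReal) :
    (Measure.pi fun _ : Fin n => Measure.pi fun _ : Fin k => gaussianReal 0 v) =
      (stdGaussian (EuclideanSpace ℝ (Fin n × Fin k))).map (scaledMatrix √(v : ℝ)) := by
  have hv : (gaussianReal 0 1).map (fun x => √(v : ℝ) * x) = gaussianReal 0 v := by
    rw [gaussianReal_map_const_mul]
    congr 1
    · simp
    · ext
      simp
  have hprod : (Measure.pi fun _ : Fin n × Fin k => gaussianReal 0 v) =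
      (Measure.pi fun _ : Fin n × Fin k => gaussianReal 0 1).map
        (fun x q => √(v : ℝ) * x q) := by
    rw [Measure.pi_map_pi (fun _ => by fun_prop)]
    simp only [hv]
  have hcurry := Measure.infinitePi_map_curry (fun (_ : Fin n) (_ : Fin k) => gaussianReal 0 v)
  simp only [Measure.infinitePi_eq_pi] at hcurry
  rw [← hcurry, hprod, ← map_pi_eq_stdGaussian, Measure.map_map (by fun_prop) (by fun_prop),
    Measure.map_map (continuous_scaledMatrix _).measurable (by fun_prop)]
  rfl

/-- Left multiplication by an orthogonal matrix, as a linear isometry of the matrix space. -/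
lemma exists_linearIsometryEquiv_mul_left {U : Matrix (Fin n) (Fin n) ℝ} (hU : Uᵀ * U = 1)
    (c : ℝ) : ∃ e : EuclideanSpace ℝ (Fin n × Fin k) ≃ₗᵢ[ℝ] EuclideanSpace ℝ (Fin n × Fin k),
      ∀ x, scaledMatrix c (e x) = U * scaledMatrix c x := by
  let L : EuclideanSpace ℝ (Fin n × Fin k) →ₗ[ℝ] EuclideanSpace ℝ (Fin n × Fin k) :=
    { toFun := fun x => WithLp.toLp 2 fun q => ∑ l, U q.1 l * x (l, q.2)
      map_add' := fun x y => by
        ext q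
        simp [mul_add, Finset.sum_add_distrib]
      map_smul' := fun a x => by
        ext q
        simp [Finset.mul_sum, mul_left_comm] }
  have hL : ∀ x, ‖L x‖ = ‖x‖ := fun x => by
    rw [EuclideanSpace.norm_eq, EuclideanSpace.norm_eq]
    congr 1
    simp only [Fintype.sum_prod_type_right]
    refine Finset.sum_congr rfl fun j _ => ?_
    have h : (U *ᵥ fun l => x (l, j)) ⬝ᵥ (U *ᵥ fun l => x (l, j)) =
        (fun l => x (l, j)) ⬝ᵥ fun l => x (l, j) := by
      rw [Matrix.dotProduct_mulVec, Matrix.vecMul_mulVec, hU, Matrix.vecMul_one]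
    simpa [L, dotProduct, Matrix.mulVec, ← sq] using h
  refine ⟨LinearIsometry.toLinearIsometryEquiv ⟨L, hL⟩ rfl, fun x => ?_⟩
  ext i j
  simp [scaledMatrix, L, Matrix.mul_apply, Finset.mul_sum, mul_left_comm]

lemma map_mul_left_map_scaledMatrix {U : Matrix (Fin n) (Fin n) ℝ} (hU : Uᵀ * U = 1) (c : ℝ) :
    ((stdGaussian (EuclideanSpace ℝ (Fin n × Fin k))).map (scaledMatrix c)).map (fun A => U * A) =
      (stdGaussian _).map (scaledMatrix c) := by
  obtain ⟨e, he⟩ := exists_linearIsometryEquiv_mul_left (k := k) hU c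
  have hs := (continuous_scaledMatrix (n := n) (k := k) c).measurable
  conv_rhs => rw [← stdGaussian_map e]
  rw [Measure.map_map (measurable_matrix_mul_left U) hs,
    Measure.map_map hs e.continuous.measurable]
  congr 1
  ext1 x
  exact (he x).symm

lemma integrable_entry_map_scaledMatrix (c : ℝ) (i : Fin n) (j : Fin k) :
    Integrable (fun A : Matrix (Fin n) (Fin k) ℝ => A i j)
      ((stdGaussian (EuclideanSpace ℝ (Fin n × Fin k))).map (scaledMatrix c)) := by
  rw [integrable_map_measure (measurable_matrix_entry i j).aestronglyMeasurable
    (continuous_scaledMatrix c).aemeasurable]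
  exact ((EuclideanSpace.proj (𝕜 := ℝ) (i, j)).integrable_comp IsGaussian.integrable_id).const_mul c

lemma euclNorm_scaledMatrix_mulVec_le {c b : ℝ} (hc : 0 ≤ c) (hn : 0 < n) (hk : 0 < k)
    {x : EuclideanSpace ℝ (Fin n × Fin k)}
    (hb : ∀ u v, ‖u‖ = 1 → ‖v‖ = 1 → inner ℝ (rankOne u v) x ≤ b) (w : Fin k → ℝ)
    (hw : euclNorm w ≤ 1) : euclNorm (scaledMatrix c x *ᵥ w) ≤ c * b := by
  have unit : ∀ (l : ℕ) (_ : 0 < l) (z : EuclideanSpace ℝ (Fin l)),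
      ∃ u : EuclideanSpace ℝ (Fin l), ‖u‖ = 1 ∧ z = ‖z‖ • u := fun l hl z => by
    rcases eq_or_ne z 0 with rfl | hz
    · exact ⟨EuclideanSpace.single ⟨0, hl⟩ 1, by simp, by simp⟩
    · have := norm_ne_zero_iff.2 hz
      exact ⟨‖z‖⁻¹ • z, by simp [norm_smul, this], by simp [smul_smul, this]⟩
  let y : EuclideanSpace ℝ (Fin n) := WithLp.toLp 2 fun i => ∑ j, x (i, j) * w j
  obtain ⟨v, hv, hwv⟩ := unit k hk (WithLp.toLp 2 w)
  obtain ⟨u, hu, hyu⟩ := unit n hn y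
  rw [euclNorm_eq_norm] at hw
  have hb0 : 0 ≤ b := by
    have h1 := hb u v hu hv
    have h2 := hb (-u) v (by simpa) hv
    simp only [inner_rankOne, PiLp.neg_apply, neg_mul, Finset.sum_neg_distrib] at h1 h2
    linarith
  have hy : ‖y‖ ≤ b := by
    have h1 : ‖y‖ = inner ℝ u y := by
      conv_rhs => rw [hyu, inner_smul_right, real_inner_self_eq_norm_sq, hu]
      simp
    have h2 : inner ℝ u y = ‖WithLp.toLp 2 w‖ * inner ℝ (rankOne u v) x := by
      have hwj : ∀ j, w j = ‖WithLp.toLp 2 w‖ * v j := fun j => by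
        simpa using congrArg (fun z : EuclideanSpace ℝ (Fin k) => z j) hwv
      rw [inner_rankOne, PiLp.inner_apply, Finset.mul_sum]
      refine Finset.sum_congr rfl fun i _ => ?_
      rw [mul_left_comm, Finset.mul_sum]
      simp only [y, RCLike.inner_apply, conj_trivial]
      rw [mul_comm]
      congr 1
      refine Finset.sum_congr rfl fun j _ => ?_
      rw [hwj j]
      ring
    rw [h1, h2]
    exact (mul_le_mul_of_nonneg_left (hb u v hu hv) (norm_nonneg _)).trans
      (mul_le_of_le_one_left hb0 hw)
  have hcy : WithLp.toLp 2 (scaledMatrix c x *ᵥ w) = c • y := by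
    ext i
    simp [scaledMatrix, y, Matrix.mulVec, dotProduct, Finset.mul_sum, mul_assoc]
  rw [euclNorm_eq_norm, hcy, norm_smul, Real.norm_of_nonneg hc]
  exact mul_le_mul_of_nonneg_left hy hc

end GaussianMatrix

/-- **Partial converse I.**  Let `k = ρ n` with `ρ ∈ (0,1]`.  Let `μ` be the Haar
probability measure on the Stiefel manifold `V_k^n` and let `ν` be the law of an `n × k`
matrix with independent `N(0, 1/n)` entries.  For every right operator ideal norm `T`
(a norm with `T(A·B) ≤ T(A)·‖B‖` where `‖·‖` is the spectral norm),
`E T(G) ≤ (1 + √ρ) · E T(Q)`. -/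
theorem partial_converse_I
    (n k : ℕ) (hn : 0 < n) (hk : 0 < k) (ρ : ℝ) (hρ0 : 0 < ρ) (hρ1 : ρ ≤ 1)
    (hkn : (k : ℝ) = ρ * n)
    (μ : Measure (Matrix (Fin n) (Fin k) ℝ)) [IsProbabilityMeasure μ]
    (hμ_stiefel : ∀ᵐ Q ∂μ, Qᵀ * Q = 1)
    (hμ_inv : ∀ U : Matrix (Fin n) (Fin n) ℝ, Uᵀ * U = 1 →
      μ.map (fun Q => U * Q) = μ)
    (ν : Measure (Matrix (Fin n) (Fin k) ℝ))
    (hν : ν = Measure.pi fun _ : Fin n => Measure.pi fun _ : Fin k =>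
      gaussianReal 0 ((n : NNReal))⁻¹)
    (T : Matrix (Fin n) (Fin k) ℝ → ℝ)
    (hT_add : ∀ A B, T (A + B) ≤ T A + T B)
    (hT_smul : ∀ (c : ℝ) (A), T (c • A) = |c| * T A)
    (hT_def : ∀ A, T A = 0 ↔ A = 0)
    (hT_ideal : ∀ (A : Matrix (Fin n) (Fin k) ℝ) (B : Matrix (Fin k) (Fin k) ℝ),
      T (A * B) ≤ T A * specNorm B) :
    ∫ G, T G ∂ν ≤ (1 + Real.sqrt ρ) * ∫ Q, T Q ∂μ := by
  have hkn' : k ≤ n := by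
    have hn' : (0 : ℝ) < n := by exact_mod_cast hn
    have : (k : ℝ) ≤ n := by nlinarith
    exact_mod_cast this
  have hn' : (0 : ℝ) < n := by exact_mod_cast hn
  let p : Seminorm ℝ (Matrix (Fin n) (Fin k) ℝ) := Seminorm.of T hT_add hT_smul
  change ∫ G, p G ∂ν ≤ (1 + √ρ) * ∫ Q, p Q ∂μ
  obtain ⟨H, hH, hHr⟩ := exists_isMulRightInvariant_orthogonalGroup n
  set s : ℝ := √(((n : NNReal)⁻¹ : NNReal) : ℝ) with hs
  have hνs := hν.trans (pi_gaussianReal_eq_map_stdGaussian _)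
  have hscaled := (continuous_scaledMatrix (n := n) (k := k) s).aemeasurable
    (μ := stdGaussian (EuclideanSpace ℝ (Fin n × Fin k)))
  have hνp : IsProbabilityMeasure ν := by
    rw [hνs]
    exact Measure.isProbabilityMeasure_map hscaled
  have hνi : ∀ i j, Integrable (fun A : Matrix (Fin n) (Fin k) ℝ => A i j) ν := fun i j => by
    rw [hνs]
    exact integrable_entry_map_scaledMatrix _ i j
  have hμi : ∀ i j, Integrable (fun A : Matrix (Fin n) (Fin k) ℝ => A i j) μ := fun i j =>
    (integrable_const (1 : ℝ)).mono' (measurable_matrix_entry i j).aestronglyMeasurable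
      (hμ_stiefel.mono fun Q hQ => abs_entry_le_one_of_transpose_mul_self hQ i j)
  have hμavg : orthogonalAverage H p (coordEmbed hkn') ≤ ∫ Q, p Q ∂μ := by
    rw [← integral_orthogonalAverage H p hμi hμ_inv]
    have := integral_mono_ae (integrable_const (orthogonalAverage H p (coordEmbed hkn')))
      (integrable_orthogonalAverage H p hμi)
      (hμ_stiefel.mono fun Q hQ => orthogonalAverage_coordEmbed_le H p hT_ideal hkn' hQ)
    simpa using this
  have hνinv : ∀ U : Matrix (Fin n) (Fin n) ℝ, Uᵀ * U = 1 → ν.map (fun A => U * A) = ν :=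
    fun U hU => by
      rw [hνs]
      exact map_mul_left_map_scaledMatrix hU _
  have hνavg : ∫ G, p G ∂ν =
      ∫ x, orthogonalAverage H p (scaledMatrix s x) ∂(stdGaussian _) := by
    have hi := integrable_orthogonalAverage H p hνi
    rw [← integral_orthogonalAverage H p hνi hνinv]
    rw [hνs] at hi ⊢
    exact integral_map hscaled hi.aestronglyMeasurable
  have : Nonempty (Fin n) := ⟨⟨0, hn⟩⟩
  have : Nonempty (Fin k) := ⟨⟨0, hk⟩⟩
  have hs0 : 0 ≤ s := Real.sqrt_nonneg _
  have hsn : s * √n = 1 := by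
    rw [hs, ← Real.sqrt_mul (by positivity)]
    simp [hn'.ne']
  have hsk : s * √k = √ρ := by
    rw [hs, ← Real.sqrt_mul (by positivity), hkn]
    congr 1
    simp
    field_simp
  have bound : ∀ ε : ℝ, 0 < ε → ∫ G, p G ∂ν ≤
      (orthogonalAverage H p (coordEmbed hkn')) * (1 + √ρ + s * ε) := fun ε hε => by
    obtain ⟨f, hfi, hf, hfle⟩ := exists_integrable_rankOne_le (ι := Fin n) (κ := Fin k) hε
    simp only [Fintype.card_fin] at hfle
    have hi : Integrable (fun x => orthogonalAverage H p (scaledMatrix s x)) (stdGaussian _) := by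
      have := integrable_orthogonalAverage H p hνi
      rw [hνs] at this
      exact this.comp_aemeasurable hscaled
    calc ∫ G, p G ∂ν
        = ∫ x, orthogonalAverage H p (scaledMatrix s x) ∂(stdGaussian _) := hνavg
      _ ≤ ∫ x, orthogonalAverage H p (coordEmbed hkn') * (s * f x) ∂(stdGaussian _) :=
          integral_mono hi ((hfi.const_mul _).const_mul _) fun x =>
            orthogonalAverage_le H p hT_ideal hkn'
              (euclNorm_scaledMatrix_mulVec_le hs0 hn hk (hf x))
      _ = orthogonalAverage H p (coordEmbed hkn') * (s * ∫ x, f x ∂(stdGaussian _)) := by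
          rw [integral_const_mul, integral_const_mul]
      _ ≤ orthogonalAverage H p (coordEmbed hkn') * (s * (√n + √k + ε)) := by
          have := orthogonalAverage_nonneg H p (coordEmbed hkn')
          gcongr
      _ = orthogonalAverage H p (coordEmbed hkn') * (1 + √ρ + s * ε) := by
          rw [mul_add s, mul_add s, hsn, hsk]
  have hlim : Filter.Tendsto (fun ε : ℝ =>
      (orthogonalAverage H p (coordEmbed hkn')) * (1 + √ρ + s * ε))
      (nhdsWithin 0 (Set.Ioi 0))
      (nhds (orthogonalAverage H p (coordEmbed hkn') * (1 + √ρ + s * 0))) :=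
    (Continuous.tendsto (by fun_prop) 0).mono_left nhdsWithin_le_nhds
  refine (ge_of_tendsto hlim (eventually_mem_nhdsWithin.mono bound)).trans ?_
  rw [mul_zero, add_zero, mul_comm]
  exact mul_le_mul_of_nonneg_left hμavg (by positivity)
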